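/- Mixing of sums from sums of mixings under incompatibility (bigbmix-sum): let I be an index set and (P_x)_{x∈I}, (Q_x)_{x∈I} families of SL propositions such that P_x ♯ Q_y for all x, y ∈ I with x ≠ y. Then the entailment (⊕_{x∈I} P_x) + (⊕_{x∈I} Q_x) ⊢ ⊕_{x∈I}(P_x + Q_x) holds. -/

import Mathlib

open scoped Classical

noncomputable section

namespace QSL

/-! ## Resources -/

/-- Vectors over the Hilbert space with orthonormal basis indexed by `Q → {0,1}`. -/
def Vec {Qubit : Type} (Q : Finset Qubit) : Type := ({ q // q ∈ Q } → Bool) → ℂ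

/-- A quantum state: a finite set of qubits together with a vector over them. -/
def QState (Qubit : Type) : Type := Σ Q : Finset Qubit, Vec Q

/-- A store: a partial function from variables to values. -/
def Store (Var Val : Type) : Type := Var → Option Val

/-- A resource: a quantum state together with a store. -/
def Res (Qubit Var Val : Type) : Type := QState Qubit × Store Var Val

variable {Qubit Var Val : Type}

/-- Tensor product of vectors over disjoint qubit sets. -/
def tensorVec {Q Q' : Finset Qubit} (v : Vec Q) (w : Vec Q') : Vec (Q ∪ Q') := fun f =>
  v (fun q => f ⟨q.1, Finset.mem_union_left _ q.2⟩) *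
  w (fun q => f ⟨q.1, Finset.mem_union_right _ q.2⟩)

/-- Transport of a vector along an equality of qubit sets. -/
def castVec {Q Q' : Finset Qubit} (h : Q = Q') (v : Vec Q) : Vec Q' := h ▸ v

/-- The empty quantum state with scalar 1. -/
def unitQ : QState Qubit := ⟨(∅ : Finset Qubit), fun _ => 1⟩

/-- The unit resource: empty qubit set with scalar 1 and the empty store. -/
def unitRes : Res Qubit Var Val := (unitQ, fun _ => none)

/-- Partial product of resources: defined iff the qubit sets are disjoint and
the store domains are disjoint; takes the union of qubit sets, tensor product of
vectors, and union of stores. -/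
def rmul (a b : Res Qubit Var Val) : Option (Res Qubit Var Val) :=
  if h : Disjoint a.1.1 b.1.1 ∧ ∀ x, a.2 x = none ∨ b.2 x = none then
    some (⟨a.1.1 ∪ b.1.1, tensorVec a.1.2 b.1.2⟩, fun x => a.2 x <|> b.2 x)
  else none

/-- Partial sum of resources: defined iff the two resources have the same
qubit set and the same store; adds the vectors. -/
def radd (a b : Res Qubit Var Val) : Option (Res Qubit Var Val) :=
  if h : a.1.1 = b.1.1 ∧ a.2 = b.2 then
    some (⟨b.1.1, fun f => castVec h.1 a.1.2 f + b.1.2 f⟩, b.2)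
  else none

/-- Incompatibility of resources: some variable lies in both store domains and
the stores disagree on it. -/
def incompat (a b : Res Qubit Var Val) : Prop :=
  ∃ x u u', a.2 x = some u ∧ b.2 x = some u' ∧ u ≠ u'

/-! ## Multisets (possibly infinite, as families up to bijective reindexing) -/

/-- An indexed family representing a multiset. -/
structure PreMSet (A : Type) : Type 1 where
  idx : Type
  val : idx → A

/-- Equivalence of indexed families by bijective reindexing. -/
def msetEquiv {A : Type} (f g : PreMSet A) : Prop :=
  ∃ e : f.idx ≃ g.idx, ∀ i, f.val i = g.val (e i)

theorem msetEquiv_refl {A : Type} (f : PreMSet A) : msetEquiv f f :=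
  ⟨Equiv.refl _, fun _ => rfl⟩

theorem msetEquiv_symm {A : Type} {f g : PreMSet A} : msetEquiv f g → msetEquiv g f
  | ⟨e, h⟩ => ⟨e.symm, fun i => by rw [h (e.symm i), Equiv.apply_symm_apply]⟩

theorem msetEquiv_trans {A : Type} {f g k : PreMSet A} :
    msetEquiv f g → msetEquiv g k → msetEquiv f k
  | ⟨e, h⟩, ⟨e', h'⟩ => ⟨e.trans e', fun i => (h i).trans (h' (e i))⟩

instance msetSetoid (A : Type) : Setoid (PreMSet A) :=
  ⟨msetEquiv, ⟨msetEquiv_refl, msetEquiv_symm, msetEquiv_trans⟩⟩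

/-- Multisets over `A`: families up to bijective reindexing. -/
def MSet (A : Type) : Type 1 := Quotient (msetSetoid A)

def MSet.mk {A : Type} (I : Type) (f : I → A) : MSet A :=
  Quotient.mk (msetSetoid A) ⟨I, f⟩

/-- A canonical representative family of a multiset. -/
def MSet.out {A : Type} (m : MSet A) : PreMSet A := Quotient.out m

/-- `a` is an occurrence of the multiset `m`. -/
def MSet.MemM {A : Type} (a : A) (m : MSet A) : Prop := ∃ i, m.out.val i = a

def MSet.map {A B : Type} (f : A → B) (m : MSet A) : MSet B :=
  MSet.mk m.out.idx (fun i => f (m.out.val i))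

/-- Sum (disjoint union) of two multisets. -/
def MSet.uplus {A : Type} (m m' : MSet A) : MSet A :=
  MSet.mk (m.out.idx ⊕ m'.out.idx) (Sum.elim m.out.val m'.out.val)

/-- Indexed sum (disjoint union) of a family of multisets. -/
def MSet.biguplus {A : Type} (I : Type) (f : I → MSet A) : MSet A :=
  MSet.mk (Σ x : I, (f x).out.idx) (fun p => (f p.1).out.val p.2)


/-- Partial product of multisets of resources: an occurrence `a·b` for every
pair of occurrences, defined iff all these resource products are defined. -/
def mprodM (m m' : MSet (Res Qubit Var Val)) : Option (MSet (Res Qubit Var Val)) :=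
  if h : ∀ (i : m.out.idx) (j : m'.out.idx), (rmul (m.out.val i) (m'.out.val j)).isSome then
    some (MSet.mk (m.out.idx × m'.out.idx)
      (fun p => (rmul (m.out.val p.1) (m'.out.val p.2)).get (h p.1 p.2)))
  else none

/-- Sum of the two projections of a multiset of pairs of resources (the
multiset of pairs plays the role of a multiset bijection between its two
projections): defined iff all the componentwise resource sums are defined. -/
def msumr (r : MSet (Res Qubit Var Val × Res Qubit Var Val)) :
    Option (MSet (Res Qubit Var Val)) :=
  if h : ∀ i, (radd (r.out.val i).1 (r.out.val i).2).isSome then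
    some (MSet.mk r.out.idx (fun i => (radd (r.out.val i).1 (r.out.val i).2).get (h i)))
  else none

/-! ## SL propositions -/

/-- An SL proposition: a set of multisets of resources. -/
abbrev SLProp (Qubit Var Val : Type) : Type 1 := Set (MSet (Res Qubit Var Val))


/-- Entailment of SL propositions: set inclusion. -/
def entails (P Q : SLProp Qubit Var Val) : Prop := P ⊆ Q

/-- Separating conjunction. -/
def star (P Q : SLProp Qubit Var Val) : SLProp Qubit Var Val :=
  { m | ∃ mp ∈ P, ∃ mq ∈ Q, mprodM mp mq = some m }

/-- Sum of SL propositions: all defined sums `m +_r m'` over `m ∈ P`, `m' ∈ Q`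
and multiset bijections `r` between `m` and `m'`. -/
def propSum (P Q : SLProp Qubit Var Val) : SLProp Qubit Var Val :=
  { m | ∃ r : MSet (Res Qubit Var Val × Res Qubit Var Val),
      MSet.map Prod.fst r ∈ P ∧ MSet.map Prod.snd r ∈ Q ∧ msumr r = some m }

/-- Indexed bare mixing. -/
def bigMix (I : Type) (P : I → SLProp Qubit Var Val) : SLProp Qubit Var Val :=
  { m | ∃ f : I → MSet (Res Qubit Var Val), (∀ x, f x ∈ P x) ∧ m = MSet.biguplus I f }

/-- Binary bare mixing, the case of `bigMix` over a two-element index set. -/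
def binMix (P Q : SLProp Qubit Var Val) : SLProp Qubit Var Val :=
  bigMix Bool (fun b => if b then Q else P)

/-- Precision: any two multisets in `P` are equal. -/
def precise (P : SLProp Qubit Var Val) : Prop := ∀ m ∈ P, ∀ m' ∈ P, m = m'

/-- Non-emptiness of behaviours: every multiset in `P` is nonempty. -/
def nonnb (P : SLProp Qubit Var Val) : Prop := ∀ m ∈ P, Nonempty (MSet.out m).idx

/-- Unambiguity: any two occurrences at distinct indices are incompatible. -/
def unambig (P : SLProp Qubit Var Val) : Prop :=
  ∀ m ∈ P, ∀ i j : (MSet.out m).idx, i ≠ j → incompat (m.out.val i) (m.out.val j)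

/-- Incompatibility of SL propositions: every occurrence of every `m ∈ P` is
incompatible with every occurrence of every `m' ∈ Q`. -/
def propIncompat (P Q : SLProp Qubit Var Val) : Prop :=
  ∀ m ∈ P, ∀ m' ∈ Q, ∀ (i : (MSet.out m).idx) (j : (MSet.out m').idx),
    incompat (m.out.val i) (m'.out.val j)

/-- The singleton proposition of the one-element multiset of a resource. -/
def singletonProp (a : Res Qubit Var Val) : SLProp Qubit Var Val :=
  { m | m = MSet.mk PUnit (fun _ => a) }

/-- The points-to proposition `ι ↦ v`: empty quantum state (scalar 1) and the
store mapping only `ι` to `v`. -/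
def varPoints (ι : Var) (v : Val) : SLProp Qubit Var Val :=
  singletonProp (unitQ, fun y => if y = ι then some v else none)

/-- Tagged mixing over an index set of values. -/
def taggedMix (ι : Var) (I : Set Val) (P : Val → SLProp Qubit Var Val) :
    SLProp Qubit Var Val :=
  bigMix I (fun x => star (varPoints ι x.1) (P x.1))

theorem mk_eq_iff {A : Type} {J K : Type} {v : J → A} {w : K → A} :
    MSet.mk J v = MSet.mk K w ↔ ∃ e : J ≃ K, ∀ i, v i = w (e i) :=
  Quotient.eq (r := msetSetoid A)

theorem mk_out {A : Type} (m : MSet A) : MSet.mk m.out.idx m.out.val = m :=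
  Quotient.out_eq m

theorem map_mk {A B : Type} (f : A → B) (J : Type) (v : J → A) :
    MSet.map f (MSet.mk J v) = MSet.mk J (fun i => f (v i)) := by
  obtain ⟨e, he⟩ := mk_eq_iff.1 (mk_out (MSet.mk J v))
  exact mk_eq_iff.2 ⟨e, fun i => congrArg f (he i)⟩

theorem biguplus_mk {A : Type} (I : Type) (J : I → Type) (v : ∀ x, J x → A) :
    MSet.biguplus I (fun x => MSet.mk (J x) (v x)) =
      MSet.mk (Σ x, J x) (fun p => v p.1 p.2) := by
  have H := fun x => mk_eq_iff.1 (mk_out (MSet.mk (J x) (v x)))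
  choose e he using H
  exact mk_eq_iff.2 ⟨Equiv.sigmaCongrRight e, fun p => he p.1 p.2⟩

theorem msumr_mk {Qubit Var Val : Type} (J : Type)
    (v : J → Res Qubit Var Val × Res Qubit Var Val)
    (s : J → Res Qubit Var Val) (hs : ∀ i, radd (v i).1 (v i).2 = some (s i)) :
    msumr (MSet.mk J v) = some (MSet.mk J s) := by
  obtain ⟨e, he⟩ := mk_eq_iff.1 (mk_out (MSet.mk J v))
  have H : ∀ i, radd ((MSet.mk J v).out.val i).1 ((MSet.mk J v).out.val i).2
      = some (s (e i)) := fun i => by rw [he i]; exact hs _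
  unfold msumr
  rw [dif_pos (fun i => by rw [H i]; rfl)]
  refine congrArg some (mk_eq_iff.2 ⟨e, fun i => ?_⟩)
  exact Option.get_of_eq_some _ (H i)

theorem msumr_some {Qubit Var Val : Type}
    {r : MSet (Res Qubit Var Val × Res Qubit Var Val)} {m : MSet (Res Qubit Var Val)}
    (hr : msumr r = some m) : ∃ s : r.out.idx → Res Qubit Var Val,
      (∀ i, radd (r.out.val i).1 (r.out.val i).2 = some (s i)) ∧ m = MSet.mk r.out.idx s := by
  unfold msumr at hr
  split_ifs at hr with hh
  exact ⟨_, fun i => (Option.some_get (hh i)).symm, (Option.some.inj hr).symm⟩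

theorem radd_not_incompat {Qubit Var Val : Type} {a b c : Res Qubit Var Val}
    (hab : radd a b = some c) : ¬ incompat a b := by
  unfold radd at hab
  split_ifs at hab with hh
  rintro ⟨x, u, u', h1, h2, h3⟩
  rw [hh.2, h2] at h1
  exact h3 (Option.some.inj h1).symm

theorem fiber_eq {A : Type} {I J : Type} (f : I → MSet A) (v : J → A)
    (e : J ≃ Σ x, (f x).out.idx) (he : ∀ i, v i = (f (e i).1).out.val (e i).2) (x : I) :
    MSet.mk {i : J // (e i).1 = x} (fun i => v i.1) = f x := by
  rw [← mk_out (f x)]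
  refine Eq.symm (mk_eq_iff.2 ⟨Equiv.ofBijective
    (fun k => ⟨e.symm ⟨x, k⟩, by simp⟩) ⟨?_, ?_⟩, ?_⟩)
  · intro k k' hk
    have := e.symm.injective (Subtype.ext_iff.1 hk)
    simpa using this
  · rintro ⟨i, rfl⟩
    exact ⟨(e i).2, Subtype.ext (e.symm_apply_apply i)⟩
  · intro k
    have := he (e.symm ⟨x, k⟩)
    rw [Equiv.apply_symm_apply] at this
    exact this.symm

theorem fiber_eq' {A : Type} {I J : Type} (f : I → MSet A) (v : J → A)
    (e : J ≃ Σ x, (f x).out.idx) (he : ∀ i, v i = (f (e i).1).out.val (e i).2) (x : I)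
    (t : J → I) (ht : ∀ i, t i = (e i).1) :
    MSet.mk {i : J // t i = x} (fun i => v i.1) = f x := by
  obtain rfl : t = fun i => (e i).1 := funext ht
  exact fiber_eq f v e he x

/-- Mixing of sums from sums of mixings, under pairwise incompatibility:
`(⊕ₓ Pₓ) + (⊕ₓ Qₓ) ⊢ ⊕ₓ(Pₓ + Qₓ)`. -/
theorem bigbmix_sum {Qubit Var Val : Type} (I : Type)
    (P Q : I → SLProp Qubit Var Val)
    (h : ∀ x y : I, x ≠ y → propIncompat (P x) (Q y)) :
    entails (propSum (bigMix I P) (bigMix I Q))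
      (bigMix I (fun x => propSum (P x) (Q x))) := by
  rintro m ⟨r, ⟨f, hf, hrf⟩, ⟨g, hg, hrg⟩, hm⟩
  obtain ⟨s, hs, rfl⟩ := msumr_some hm
  obtain ⟨e, he⟩ := mk_eq_iff.1 hrf
  obtain ⟨e', he'⟩ := mk_eq_iff.1 hrg
  have key : ∀ i, (e i).1 = (e' i).1 := by
    intro i
    by_contra hne
    have := h _ _ hne _ (hf _) _ (hg _) (e i).2 (e' i).2
    rw [← he i, ← he' i] at this
    exact radd_not_incompat (hs i) this
  refine ⟨fun x => MSet.mk {i // (e i).1 = x} (fun i => s i.1), fun x => ?_, ?_⟩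
  · refine ⟨MSet.mk {i // (e i).1 = x} (fun i => r.out.val i.1), ?_, ?_, ?_⟩
    · rw [map_mk, fiber_eq f (fun i => (r.out.val i).1) e he x]
      exact hf x
    · rw [map_mk, fiber_eq' g (fun i => (r.out.val i).2) e' he' x _ key]
      exact hg x
    · exact msumr_mk _ _ _ (fun i => hs i.1)
  · rw [biguplus_mk]
    exact Eq.symm (mk_eq_iff.2 ⟨Equiv.sigmaFiberEquiv (fun i => (e i).1), fun _ => rfl⟩)
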